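/- Let G be the 7 × 7 real symmetric matrix with all diagonal entries equal to 1 and off-diagonal entries (symmetrically extended) G₁₂ = −1, G₁₃ = −√15/3, G₂₄ = −√15/3, G₃₅ = −1/2, G₄₇ = −1/2, G₅₆ = −1/2, G₆₇ = −1/2, G₅₇ = −1/2, and all other off-diagonal entries 0. Then G has exactly 4 positive eigenvalues (with multiplicity), exactly 1 negative eigenvalue, and exactly 2 zero eigenvalues; equivalently G has rank 5 and signature (4,1). -/

import Mathlib

open Real

noncomputable def G2 : Matrix (Fin 7) (Fin 7) ℝ :=
  !![1, -1, -(Real.sqrt 15 / 3), 0, 0, 0, 0;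
     -1, 1, 0, -(Real.sqrt 15 / 3), 0, 0, 0;
     -(Real.sqrt 15 / 3), 0, 1, 0, -(1/2), 0, 0;
     0, -(Real.sqrt 15 / 3), 0, 1, 0, 0, -(1/2);
     0, 0, -(1/2), 0, 1, -(1/2), -(1/2);
     0, 0, 0, 0, -(1/2), 1, -(1/2);
     0, 0, 0, -(1/2), -(1/2), -(1/2), 1]

namespace Matrix

open QuadraticMap QuadraticForm

variable {n : Type*} [Fintype n] [DecidableEq n]

lemma toQuadraticForm'_equivalent_weightedSumSquares {R : Type*} [CommRing R] {A P : Matrix n n R}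
    {w : n → R} (hP : IsUnit P) (h : ∀ x, x ⬝ᵥ A *ᵥ x = ∑ i, w i * ((P *ᵥ x) i * (P *ᵥ x) i)) :
    Equivalent A.toQuadraticForm' (weightedSumSquares R w) :=
  ⟨{ toLinearEquiv' P hP.invertible with
    map_app' := fun x ↦ by
      change weightedSumSquares R w (P *ᵥ x) = Matrix.toLinearMap₂' R A x x
      rw [weightedSumSquares_apply, Matrix.toLinearMap₂'_apply', h]
      simp only [smul_eq_mul] }⟩

lemma IsHermitian.toQuadraticForm'_equivalent_eigenvalues {A : Matrix n n ℝ}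
    (hA : A.IsHermitian) :
    Equivalent A.toQuadraticForm' (weightedSumSquares ℝ hA.eigenvalues) := by
  refine toQuadraticForm'_equivalent_weightedSumSquares
    (P := star (hA.eigenvectorUnitary : Matrix n n ℝ))
    (Unitary.isUnit_coe (U := star hA.eigenvectorUnitary)) fun x ↦ ?_
  conv_lhs => rw [hA.spectral_theorem, Unitary.conjStarAlgAut_apply]
  rw [← mulVec_mulVec, ← mulVec_mulVec, dotProduct_mulVec, star_eq_conjTranspose,
    conjTranspose_eq_transpose_of_trivial, ← mulVec_transpose, dotProduct]
  refine Finset.sum_congr rfl fun i _ ↦ ?_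
  simp only [mulVec_diagonal, Function.comp_apply, RCLike.ofReal_real_eq_id, id_eq]
  ring

/-- **Sylvester's law of inertia** for the eigenvalues of a real symmetric matrix whose quadratic
form is a weighted sum of squares of independent linear forms. -/
lemma IsHermitian.card_eigenvalues_of_sum_squares {A P : Matrix n n ℝ} (hA : A.IsHermitian)
    {w : n → ℝ} (hP : IsUnit P)
    (h : ∀ x, x ⬝ᵥ A *ᵥ x = ∑ i, w i * ((P *ᵥ x) i * (P *ᵥ x) i)) :
    (Finset.univ.filter fun j ↦ 0 < hA.eigenvalues j).card =
        (Finset.univ.filter fun j ↦ 0 < w j).card ∧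
      (Finset.univ.filter fun j ↦ hA.eigenvalues j < 0).card =
        (Finset.univ.filter fun j ↦ w j < 0).card := by
  have key := toQuadraticForm'_equivalent_weightedSumSquares hP h
  have eig := hA.toQuadraticForm'_equivalent_eigenvalues
  constructor
  · simpa [Set.ncard_eq_toFinset_card'] using
      (sigPos_of_equiv_weightedSumSquares eig).symm.trans (sigPos_of_equiv_weightedSumSquares key)
  · simpa [Set.ncard_eq_toFinset_card'] using
      (sigNeg_of_equiv_weightedSumSquares eig).symm.trans (sigNeg_of_equiv_weightedSumSquares key)

end Matrix

/-- The rows are independent linear forms which diagonalize the quadratic form of `G2`. -/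
noncomputable def G2Forms : Matrix (Fin 7) (Fin 7) ℝ :=
  !![-(√15 / 3), -(√15 / 3), 1, 1, -(1 / 2), 0, -(1 / 2);
     √15 / 3, √15 / 3, 0, 0, 1 / 2, 0, 1 / 2;
     0, 0, 0, 0, 1 / 2, -1, 1 / 2;
     1, -1, -(√15 / 6), √15 / 6, 0, 0, 0;
     0, 0, 1, -1, -3, 0, 3;
     0, 0, 0, 0, 1, 0, -1;
     0, 0, 0, 0, 0, 1, 0]

noncomputable def G2Weights : Fin 7 → ℝ := ![1 / 2, -(1 / 2), 1, 1, 1 / 12, 0, 0]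

lemma isUnit_G2Forms : IsUnit G2Forms := by
  rw [← Matrix.mulVec_injective_iff_isUnit]
  refine (injective_iff_map_eq_zero G2Forms.mulVecLin).2 fun x h ↦ ?_
  have hs : (0 : ℝ) < √15 := Real.sqrt_pos.2 (by norm_num)
  have h0 := congrFun h 0
  have h1 := congrFun h 1
  have h2 := congrFun h 2
  have h3 := congrFun h 3
  have h4 := congrFun h 4
  have h5 := congrFun h 5
  have h6 := congrFun h 6
  simp [G2Forms, Matrix.mulVec, dotProduct, Fin.sum_univ_succ] at h0 h1 h2 h3 h4 h5 h6
  have x4 : x 4 = 0 := by linarith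
  have x6 : x 6 = 0 := by linarith
  have x2 : x 2 = 0 := by linarith
  have x3 : x 3 = 0 := by linarith
  simp only [x2, x3, x4, x6] at h1 h3
  have h01 : √15 * (x 0 + x 1) = 0 := by linarith
  have h01 : x 0 + x 1 = 0 := (mul_eq_zero.1 h01).resolve_left hs.ne'
  have x0 : x 0 = 0 := by linarith
  have x1 : x 1 = 0 := by linarith
  ext i
  fin_cases i <;> assumption

lemma dotProduct_G2_mulVec (x : Fin 7 → ℝ) :
    x ⬝ᵥ G2.mulVec x = ∑ i, G2Weights i * (G2Forms.mulVec x i * G2Forms.mulVec x i) := by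
  have hs : √15 * √15 = 15 := Real.mul_self_sqrt (by norm_num)
  simp [G2, G2Forms, G2Weights, Matrix.mulVec, dotProduct, Fin.sum_univ_succ]
  linear_combination -(1 / 36) * (x 2 - x 3) ^ 2 * hs

theorem stmt_2 (hG : G2.IsHermitian) :
    (Finset.univ.filter fun j => 0 < hG.eigenvalues j).card = 4 ∧
    (Finset.univ.filter fun j => hG.eigenvalues j < 0).card = 1 ∧
    (Finset.univ.filter fun j => hG.eigenvalues j = 0).card = 2 ∧
    G2.rank = 5 := by
  obtain ⟨hpos, hneg⟩ := hG.card_eigenvalues_of_sum_squares isUnit_G2Forms dotProduct_G2_mulVec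
  have hw_pos : (Finset.univ.filter fun j ↦ 0 < G2Weights j).card = 4 := by
    norm_num [Finset.card_filter, Fin.sum_univ_succ, G2Weights, -Finset.sum_boole]
  have hw_neg : (Finset.univ.filter fun j ↦ G2Weights j < 0).card = 1 := by
    norm_num [Finset.card_filter, Fin.sum_univ_succ, G2Weights, -Finset.sum_boole]
  have hsum : (Finset.univ.filter fun j => 0 < hG.eigenvalues j).card +
      (Finset.univ.filter fun j => hG.eigenvalues j < 0).card +
      (Finset.univ.filter fun j => hG.eigenvalues j = 0).card = 7 := by
    rw [← Finset.card_union_of_disjoint, ← Finset.card_union_of_disjoint]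
    · exact (congrArg Finset.card (by grind)).trans (Finset.card_fin 7)
    all_goals exact Finset.disjoint_left.2 (by grind)
  have hrank : G2.rank + (Finset.univ.filter fun j => hG.eigenvalues j = 0).card = 7 := by
    rw [hG.rank_eq_card_non_zero_eigs, Fintype.card_subtype, add_comm]
    simpa using Finset.card_filter_add_card_filter_not (s := Finset.univ)
      (fun j => hG.eigenvalues j = 0)
  omega
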